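/- Let f and ν satisfy the adapted coordinate conditions at the first-kind singular point p = (0,0) as in the context. Then the Gaussian curvature K is bounded on the set of regular points in some neighborhood of p if and only if the product curvature κ_Π(u) := ⟨f_uu(u,0), ν(u,0)⟩ · det(f_u(u,0), f_vv(u,0), f_vvv(u,0)) vanishes for all u near 0. -/

import Mathlib

open scoped RealInnerProductSpace
open Filter

noncomputable section

/-- Euclidean 3-space. -/
abbrev E3 : Type := EuclideanSpace ℝ (Fin 3)

/-- Partial derivative in the first (`u`) direction. -/
def pu {E : Type*} [NormedAddCommGroup E] [NormedSpace ℝ E] (f : ℝ × ℝ → E) (q : ℝ × ℝ) : E :=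
  fderiv ℝ f q (1, 0)

/-- Partial derivative in the second (`v`) direction. -/
def pv {E : Type*} [NormedAddCommGroup E] [NormedSpace ℝ E] (f : ℝ × ℝ → E) (q : ℝ × ℝ) : E :=
  fderiv ℝ f q (0, 1)

/-- Determinant of three column vectors in `ℝ³`. -/
def det3 (a b c : E3) : ℝ :=
  Matrix.det !![a 0, b 0, c 0; a 1, b 1, c 1; a 2, b 2, c 2]

/-- Cross product in `ℝ³`. -/
def cross3 (a b : E3) : E3 :=
  (WithLp.equiv 2 (Fin 3 → ℝ)).symm
    ![a 1 * b 2 - a 2 * b 1, a 2 * b 0 - a 0 * b 2, a 0 * b 1 - a 1 * b 0]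

/-- Coefficients of the first fundamental form. -/
def Ec (f : ℝ × ℝ → E3) (q : ℝ × ℝ) : ℝ := ⟪pu f q, pu f q⟫
def Fc (f : ℝ × ℝ → E3) (q : ℝ × ℝ) : ℝ := ⟪pu f q, pv f q⟫
def Gc (f : ℝ × ℝ → E3) (q : ℝ × ℝ) : ℝ := ⟪pv f q, pv f q⟫

/-- Coefficients of the second fundamental form. -/
def Lc (f ν : ℝ × ℝ → E3) (q : ℝ × ℝ) : ℝ := ⟪pu (pu f) q, ν q⟫
def Mc (f ν : ℝ × ℝ → E3) (q : ℝ × ℝ) : ℝ := ⟪pv (pu f) q, ν q⟫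
def Nc (f ν : ℝ × ℝ → E3) (q : ℝ × ℝ) : ℝ := ⟪pv (pv f) q, ν q⟫

/-- The mean curvature `H = (E N − 2 F M + G L)/(2(E G − F²))`. -/
def meanCurv (f ν : ℝ × ℝ → E3) (q : ℝ × ℝ) : ℝ :=
  (Ec f q * Nc f ν q - 2 * Fc f q * Mc f ν q + Gc f q * Lc f ν q) /
    (2 * (Ec f q * Gc f q - Fc f q ^ 2))

/-- The Gaussian curvature `K = (L N − M²)/(E G − F²)`. -/
def gaussCurv (f ν : ℝ × ℝ → E3) (q : ℝ × ℝ) : ℝ :=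
  (Lc f ν q * Nc f ν q - Mc f ν q ^ 2) / (Ec f q * Gc f q - Fc f q ^ 2)

section PartialDerivatives

variable {E : Type*} [NormedAddCommGroup E] [NormedSpace ℝ E]

lemma ContDiff.pu {g : ℝ × ℝ → E} (hg : ContDiff ℝ (⊤ : ℕ∞) g) :
    ContDiff ℝ (⊤ : ℕ∞) (pu g) :=
  (hg.fderiv_right (m := (⊤ : ℕ∞)) (by simp)).clm_apply contDiff_const

lemma ContDiff.pv {g : ℝ × ℝ → E} (hg : ContDiff ℝ (⊤ : ℕ∞) g) :
    ContDiff ℝ (⊤ : ℕ∞) (pv g) :=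
  (hg.fderiv_right (m := (⊤ : ℕ∞)) (by simp)).clm_apply contDiff_const

lemma ContDiff.differentiable_of_top {g : ℝ × ℝ → E} (hg : ContDiff ℝ (⊤ : ℕ∞) g) :
    Differentiable ℝ g :=
  hg.differentiable (by simp)

lemma hasDerivAt_pu {g : ℝ × ℝ → E} (hg : ContDiff ℝ (⊤ : ℕ∞) g) (u v : ℝ) :
    HasDerivAt (fun t => g (t, v)) (pu g (u, v)) u :=
  (hg.differentiable_of_top (u, v)).hasFDerivAt.comp_hasDerivAt u
    ((hasDerivAt_id u).prodMk (hasDerivAt_const u v))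

lemma hasDerivAt_pv {g : ℝ × ℝ → E} (hg : ContDiff ℝ (⊤ : ℕ∞) g) (u v : ℝ) :
    HasDerivAt (fun t => g (u, t)) (pv g (u, v)) v :=
  (hg.differentiable_of_top (u, v)).hasFDerivAt.comp_hasDerivAt v
    ((hasDerivAt_const v u).prodMk (hasDerivAt_id v))

/-- Mixed partial derivatives of a smooth map commute. -/
lemma pv_pu_comm {g : ℝ × ℝ → E} (hg : ContDiff ℝ (⊤ : ℕ∞) g) (q : ℝ × ℝ) :
    pv (pu g) q = pu (pv g) q := by
  have hd : DifferentiableAt ℝ (fderiv ℝ g) q :=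
    (hg.fderiv_right (m := (⊤ : ℕ∞)) (by simp)).differentiable (by simp) q
  have key : ∀ a b : ℝ × ℝ,
      fderiv ℝ (fun x => fderiv ℝ g x a) q b = fderiv ℝ (fderiv ℝ g) q b a := by
    intro a b
    rw [fderiv_clm_apply hd (differentiableAt_const a)]
    simp
  have hs : IsSymmSndFDerivAt ℝ g q :=
    hg.contDiffAt.isSymmSndFDerivAt
      (by simpa using WithTop.coe_le_coe.2 (le_top (a := (2 : ℕ∞))))
  exact (key _ _).trans ((hs _ _).trans (key _ _).symm)

end PartialDerivatives

lemma pv_inner {a b : ℝ × ℝ → E3} (ha : ContDiff ℝ (⊤ : ℕ∞) a) (hb : ContDiff ℝ (⊤ : ℕ∞) b)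
    (q : ℝ × ℝ) : pv (fun x => ⟪a x, b x⟫) q = ⟪a q, pv b q⟫ + ⟪pv a q, b q⟫ :=
  fderiv_inner_apply ℝ (ha.differentiable_of_top q) (hb.differentiable_of_top q) _

lemma pv_mul {a b : ℝ × ℝ → ℝ} (ha : ContDiff ℝ (⊤ : ℕ∞) a) (hb : ContDiff ℝ (⊤ : ℕ∞) b)
    (q : ℝ × ℝ) : pv (fun x => a x * b x) q = a q * pv b q + pv a q * b q := by
  simp only [pv]
  rw [fderiv_fun_mul (ha.differentiable_of_top q) (hb.differentiable_of_top q)]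
  simp [mul_comm]

lemma pv_add {a b : ℝ × ℝ → ℝ} (ha : ContDiff ℝ (⊤ : ℕ∞) a) (hb : ContDiff ℝ (⊤ : ℕ∞) b)
    (q : ℝ × ℝ) : pv (fun x => a x + b x) q = pv a q + pv b q := by
  simp only [pv]
  rw [fderiv_fun_add (ha.differentiable_of_top q) (hb.differentiable_of_top q)]
  rfl

lemma pv_sub {a b : ℝ × ℝ → ℝ} (ha : ContDiff ℝ (⊤ : ℕ∞) a) (hb : ContDiff ℝ (⊤ : ℕ∞) b)
    (q : ℝ × ℝ) : pv (fun x => a x - b x) q = pv a q - pv b q := by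
  simp only [pv]
  rw [fderiv_fun_sub (ha.differentiable_of_top q) (hb.differentiable_of_top q)]
  rfl

lemma pv_neg (a : ℝ × ℝ → ℝ) (q : ℝ × ℝ) : pv (fun x => -a x) q = -pv a q := by
  simp [pv, fderiv_fun_neg]

/-- A function on the line vanishing to first order at `0`, with second derivative at least `2 c`
between `0` and `v`, is at least `c * v ^ 2` at `v`. -/
lemma mul_sq_le_of_le_deriv2 {φ φ₁ φ₂ : ℝ → ℝ} (h1 : ∀ t, HasDerivAt φ (φ₁ t) t)
    (h2 : ∀ t, HasDerivAt φ₁ (φ₂ t) t) (h0 : φ 0 = 0) (h0' : φ₁ 0 = 0) {c v : ℝ}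
    (hc : ∀ s ∈ Set.Ioo (0 : ℝ) 1, 2 * c ≤ φ₂ (s * v)) : c * v ^ 2 ≤ φ v := by
  have hm : ∀ t : ℝ, HasDerivAt (fun s => s * v) v t := fun t => by
    simpa using (hasDerivAt_id t).mul_const v
  have g1 : ∀ t, HasDerivAt (fun s => φ (s * v) - c * v ^ 2 * s ^ 2)
      (φ₁ (t * v) * v - c * v ^ 2 * (2 * t)) t := fun t => by
    simpa using (HasDerivAt.comp (h₂ := φ) t (h1 (t * v)) (hm t)).fun_sub
      ((hasDerivAt_pow 2 t).const_mul (c * v ^ 2))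
  have g2 : ∀ t, HasDerivAt (fun s => φ₁ (s * v) * v - c * v ^ 2 * (2 * s))
      (φ₂ (t * v) * v * v - c * v ^ 2 * 2) t := fun t => by
    simpa using ((HasDerivAt.comp (h₂ := φ₁) t (h2 (t * v)) (hm t)).mul_const v).fun_sub
      (((hasDerivAt_id t).const_mul 2).const_mul (c * v ^ 2))
  obtain ⟨ξ, hξ, e1⟩ := exists_hasDerivAt_eq_slope _ _ (zero_lt_one' ℝ)
    (fun t _ => (g1 t).continuousAt.continuousWithinAt) (fun t _ => g1 t)
  obtain ⟨η, hη, e2⟩ := exists_hasDerivAt_eq_slope _ _ hξ.1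
    (fun t _ => (g2 t).continuousAt.continuousWithinAt) (fun t _ => g2 t)
  have hφ := hc η ⟨hη.1, hη.2.trans hξ.2⟩
  have hn : 0 ≤ φ₂ (η * v) * v * v - c * v ^ 2 * 2 := by nlinarith [sq_nonneg v]
  rw [e2, le_div_iff₀ (by linarith [hξ.1])] at hn
  simp only [zero_mul, h0', mul_zero, sub_zero] at hn
  rw [e1] at hn
  simp only [zero_mul, h0] at hn
  norm_num at hn
  linarith

/-- A smooth function vanishing to first order along the `u`-axis near the origin grows at least
quadratically in `v`, with any constant below half of its second `v`-derivative at the origin. -/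
lemma eventually_mul_sq_le {g : ℝ × ℝ → ℝ} (hg : ContDiff ℝ (⊤ : ℕ∞) g)
    (h0 : ∀ᶠ u in nhds (0 : ℝ), g (u, 0) = 0 ∧ pv g (u, 0) = 0) {c : ℝ}
    (hc : 2 * c < pv (pv g) (0, 0)) :
    ∀ᶠ q in nhds ((0, 0) : ℝ × ℝ), c * q.2 ^ 2 ≤ g q := by
  have hcont : ∀ᶠ q in nhds ((0, 0) : ℝ × ℝ), 2 * c < pv (pv g) q :=
    hg.pv.pv.continuous.continuousAt.eventually_const_lt hc
  obtain ⟨r, hr, hball⟩ := Metric.eventually_nhds_iff.1 hcont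
  have hfst : ∀ᶠ q in nhds ((0, 0) : ℝ × ℝ), g (q.1, 0) = 0 ∧ pv g (q.1, 0) = 0 :=
    (continuous_fst.tendsto ((0, 0) : ℝ × ℝ)).eventually h0
  filter_upwards [hfst, Metric.ball_mem_nhds _ hr] with q hq hqr
  obtain ⟨u, v⟩ := q
  refine mul_sq_le_of_le_deriv2 (fun t => hasDerivAt_pv hg u t)
    (fun t => hasDerivAt_pv hg.pv u t) hq.1 hq.2 (fun s hs => (hball ?_).le)
  simp only [Metric.mem_ball, Prod.dist_eq, Real.dist_eq, sub_zero, max_lt_iff, abs_mul] at hqr ⊢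
  refine ⟨hqr.1, ?_⟩
  rw [abs_of_pos hs.1]
  nlinarith [abs_nonneg v, hs.2]

/-- A smooth function vanishing to first order along the `u`-axis near the origin is bounded there
by a multiple of `v ^ 2`. -/
lemma exists_eventually_abs_le_mul_sq {g : ℝ × ℝ → ℝ} (hg : ContDiff ℝ (⊤ : ℕ∞) g)
    (h0 : ∀ᶠ u in nhds (0 : ℝ), g (u, 0) = 0 ∧ pv g (u, 0) = 0) :
    ∃ C : ℝ, 0 ≤ C ∧ ∀ᶠ q in nhds ((0, 0) : ℝ × ℝ), |g q| ≤ C * q.2 ^ 2 := by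
  set m := pv (pv g) (0, 0)
  have hneg : pv (fun x => -g x) = fun x => -pv g x := funext (pv_neg g)
  refine ⟨|m| + 1, by positivity, ?_⟩
  have hlow := eventually_mul_sq_le hg h0 (c := -(|m| + 1))
    (by linarith [neg_abs_le m, abs_nonneg m])
  have hup := eventually_mul_sq_le (g := fun x => -g x) hg.neg (c := -(|m| + 1))
    (by filter_upwards [h0] with u hu; simp [hneg, hu.1, hu.2])
    (by rw [hneg, pv_neg]; linarith [le_abs_self m, abs_nonneg m])
  filter_upwards [hlow, hup] with q h1 h2
  rw [abs_le]
  constructor <;> linarith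

/-- If `|a| ≤ C |b|` for small nonzero `v` on a vertical line, and `a`, `b`, `b_v` vanish at `v = 0`,
then so does `a_v`. -/
lemma pv_eq_zero_of_abs_le {a b : ℝ × ℝ → ℝ} (ha : ContDiff ℝ (⊤ : ℕ∞) a)
    (hb : ContDiff ℝ (⊤ : ℕ∞) b) {u C : ℝ} (ha0 : a (u, 0) = 0) (hb0 : b (u, 0) = 0)
    (hb1 : pv b (u, 0) = 0)
    (hle : ∀ᶠ v in nhds (0 : ℝ), v ≠ 0 → |a (u, v)| ≤ C * |b (u, v)|) : pv a (u, 0) = 0 := by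
  have h1 := (hasDerivAt_pv hb u 0).isLittleO
  simp only [hb0, hb1, sub_zero, smul_zero] at h1
  have h2 : (fun v => a (u, v)) =O[nhds 0] fun v => b (u, v) := by
    refine Asymptotics.IsBigO.of_bound C ?_
    filter_upwards [hle] with v hv
    rcases eq_or_ne v 0 with rfl | h
    · simp [ha0, hb0]
    · exact hv h
  refine (hasDerivAt_pv ha u 0).unique (HasDerivAt.of_isLittleO ?_)
  simpa [ha0] using h2.trans_isLittleO h1

lemma inner_cross3 (a b c : E3) : ⟪c, cross3 a b⟫ = det3 a b c := by
  simp [cross3, det3, PiLp.inner_apply, Fin.sum_univ_three, Matrix.det_fin_three]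
  ring

section Frontal

variable {f ν : ℝ × ℝ → E3}

lemma contDiff_Ec (hf : ContDiff ℝ (⊤ : ℕ∞) f) : ContDiff ℝ (⊤ : ℕ∞) (Ec f) :=
  hf.pu.inner ℝ hf.pu

lemma contDiff_Fc (hf : ContDiff ℝ (⊤ : ℕ∞) f) : ContDiff ℝ (⊤ : ℕ∞) (Fc f) :=
  hf.pu.inner ℝ hf.pv

lemma contDiff_Gc (hf : ContDiff ℝ (⊤ : ℕ∞) f) : ContDiff ℝ (⊤ : ℕ∞) (Gc f) :=
  hf.pv.inner ℝ hf.pv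

lemma contDiff_Lc (hf : ContDiff ℝ (⊤ : ℕ∞) f) (hν : ContDiff ℝ (⊤ : ℕ∞) ν) :
    ContDiff ℝ (⊤ : ℕ∞) (Lc f ν) :=
  hf.pu.pu.inner ℝ hν

lemma contDiff_Mc (hf : ContDiff ℝ (⊤ : ℕ∞) f) (hν : ContDiff ℝ (⊤ : ℕ∞) ν) :
    ContDiff ℝ (⊤ : ℕ∞) (Mc f ν) :=
  hf.pu.pv.inner ℝ hν

lemma contDiff_Nc (hf : ContDiff ℝ (⊤ : ℕ∞) f) (hν : ContDiff ℝ (⊤ : ℕ∞) ν) :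
    ContDiff ℝ (⊤ : ℕ∞) (Nc f ν) :=
  hf.pv.pv.inner ℝ hν

/-- The determinant of the first fundamental form. -/
def firstFormDet (f : ℝ × ℝ → E3) (q : ℝ × ℝ) : ℝ := Ec f q * Gc f q - Fc f q ^ 2

/-- The determinant of the second fundamental form. -/
def secondFormDet (f ν : ℝ × ℝ → E3) (q : ℝ × ℝ) : ℝ := Lc f ν q * Nc f ν q - Mc f ν q ^ 2

lemma contDiff_firstFormDet (hf : ContDiff ℝ (⊤ : ℕ∞) f) :
    ContDiff ℝ (⊤ : ℕ∞) (firstFormDet f) :=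
  ((contDiff_Ec hf).mul (contDiff_Gc hf)).sub ((contDiff_Fc hf).pow 2)

lemma contDiff_secondFormDet (hf : ContDiff ℝ (⊤ : ℕ∞) f) (hν : ContDiff ℝ (⊤ : ℕ∞) ν) :
    ContDiff ℝ (⊤ : ℕ∞) (secondFormDet f ν) :=
  ((contDiff_Lc hf hν).mul (contDiff_Nc hf hν)).sub ((contDiff_Mc hf hν).pow 2)

/-- The `v`-derivative of an expression `a b - c ^ 2`. -/
lemma pv_mul_sub_sq {a b c : ℝ × ℝ → ℝ} (ha : ContDiff ℝ (⊤ : ℕ∞) a)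
    (hb : ContDiff ℝ (⊤ : ℕ∞) b) (hc : ContDiff ℝ (⊤ : ℕ∞) c) (q : ℝ × ℝ) :
    pv (fun x => a x * b x - c x ^ 2) q =
      a q * pv b q + pv a q * b q - (c q * pv c q + pv c q * c q) := by
  simp only [sq]
  rw [pv_sub (ha.mul hb) (hc.mul hc), pv_mul ha hb, pv_mul hc hc]

lemma firstFormDet_eq_zero {q : ℝ × ℝ} (h : pv f q = 0) : firstFormDet f q = 0 := by
  simp [firstFormDet, Gc, Fc, h]

lemma pv_Gc_eq_zero (hf : ContDiff ℝ (⊤ : ℕ∞) f) {q : ℝ × ℝ} (h : pv f q = 0) :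
    pv (Gc f) q = 0 :=
  (pv_inner hf.pv hf.pv q).trans (by simp [h])

lemma pv_firstFormDet_eq_zero (hf : ContDiff ℝ (⊤ : ℕ∞) f) {q : ℝ × ℝ} (h : pv f q = 0) :
    pv (firstFormDet f) q = 0 := by
  refine (pv_mul_sub_sq (contDiff_Ec hf) (contDiff_Gc hf) (contDiff_Fc hf) q).trans ?_
  simp [pv_Gc_eq_zero hf h, Gc, Fc, h]

lemma pv_pv_firstFormDet (hf : ContDiff ℝ (⊤ : ℕ∞) f) {q : ℝ × ℝ} (h : pv f q = 0)
    (h1 : ‖pu f q‖ = 1) (h2 : ⟪pu f q, pv (pv f) q⟫ = 0) (h3 : ‖pv (pv f) q‖ = 1) :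
    pv (pv (firstFormDet f)) q = 2 := by
  have hE := contDiff_Ec hf
  have hF := contDiff_Fc hf
  have hG := contDiff_Gc hf
  have hG0 : Gc f q = 0 := by simp [Gc, h]
  have hF0 : Fc f q = 0 := by simp [Fc, h]
  have hE1 : Ec f q = 1 := by simp [Ec, h1]
  have hFv : pv (Fc f) q = 0 := (pv_inner hf.pu hf.pv q).trans (by simp [h, h2])
  have hGfun : pv (Gc f) = fun x => ⟪pv f x, pv (pv f) x⟫ + ⟪pv (pv f) x, pv f x⟫ :=
    funext (pv_inner hf.pv hf.pv)
  have hGvv : pv (pv (Gc f)) q = 2 := by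
    rw [hGfun, pv_add (hf.pv.inner ℝ hf.pv.pv) (hf.pv.pv.inner ℝ hf.pv),
      pv_inner hf.pv hf.pv.pv, pv_inner hf.pv.pv hf.pv]
    simp [h, h3]
    norm_num
  have hfun : pv (firstFormDet f) = fun x => Ec f x * pv (Gc f) x + pv (Ec f) x * Gc f x -
      (Fc f x * pv (Fc f) x + pv (Fc f) x * Fc f x) :=
    funext (pv_mul_sub_sq hE hG hF)
  rw [hfun, pv_sub ((hE.mul hG.pv).add (hE.pv.mul hG)) ((hF.mul hF.pv).add (hF.pv.mul hF)),
    pv_add (hE.mul hG.pv) (hE.pv.mul hG), pv_add (hF.mul hF.pv) (hF.pv.mul hF),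
    pv_mul hE hG.pv, pv_mul hE.pv hG, pv_mul hF hF.pv, pv_mul hF.pv hF, hG0, hF0, hE1, hFv, hGvv,
    pv_Gc_eq_zero hf h]
  norm_num

/-- The Weingarten identity `N = -⟨f_v, ν_v⟩`. -/
lemma Nc_eq (hf : ContDiff ℝ (⊤ : ℕ∞) f) (hν : ContDiff ℝ (⊤ : ℕ∞) ν)
    (hperp : ∀ q, ⟪ν q, pv f q⟫ = 0) (q : ℝ × ℝ) : Nc f ν q = -⟪pv f q, pv ν q⟫ := by
  have h := pv_inner hf.pv hν q
  have h0 : (fun x => ⟪pv f x, ν x⟫) = fun _ => (0 : ℝ) :=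
    funext fun x => by rw [real_inner_comm, hperp]
  rw [h0] at h
  simp only [pv, fderiv_fun_const, Pi.zero_apply, zero_apply] at h
  simp only [Nc, pv]
  linarith

lemma two_mul_pv_Nc (hf : ContDiff ℝ (⊤ : ℕ∞) f) (hν : ContDiff ℝ (⊤ : ℕ∞) ν)
    (hperp : ∀ q, ⟪ν q, pv f q⟫ = 0) {q : ℝ × ℝ} (h : pv f q = 0) :
    2 * pv (Nc f ν) q = ⟪pv (pv (pv f)) q, ν q⟫ := by
  have h1 : pv (Nc f ν) q = _ := pv_inner hf.pv.pv hν q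
  have h2 : pv (Nc f ν) q = -⟪pv (pv f) q, pv ν q⟫ := by
    rw [funext (Nc_eq hf hν hperp), pv_neg, pv_inner hf.pv hν.pv]
    simp [h]
  linarith

end Frontal

/-- In adapted coordinates at a singular point of the first kind, the Gaussian curvature is
bounded on the regular points of some neighborhood of the origin if and only if the product
curvature `κ_Π(u) = ⟨f_uu, ν⟩(u,0) · det(f_u, f_vv, f_vvv)(u,0)` vanishes for all `u`
near `0`. -/
theorem gauss_curvature_bounded_iff_product_curvature_vanishes
    (f ν : ℝ × ℝ → E3)
    (hf : ContDiff ℝ (⊤ : ℕ∞) f) (hν : ContDiff ℝ (⊤ : ℕ∞) ν)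
    (hfrontal : ∀ q : ℝ × ℝ, ‖ν q‖ = 1 ∧ ⟪ν q, pu f q⟫ = 0 ∧ ⟪ν q, pv f q⟫ = 0)
    (hadapted : ∀ᶠ u in nhds (0 : ℝ),
      pv f (u, 0) = 0 ∧ ‖pu f (u, 0)‖ = 1 ∧
      ⟪pu f (u, 0), pv (pv f) (u, 0)⟫ = 0 ∧ ‖pv (pv f) (u, 0)‖ = 1 ∧
      ν (u, 0) = cross3 (pu f (u, 0)) (pv (pv f) (u, 0)))
    (hreg : ∀ᶠ q in nhds ((0, 0) : ℝ × ℝ), q.2 ≠ 0 → Ec f q * Gc f q - Fc f q ^ 2 ≠ 0) :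
    (∃ (W : Set (ℝ × ℝ)) (C : ℝ), IsOpen W ∧ (0, 0) ∈ W ∧
        ∀ q ∈ W, Ec f q * Gc f q - Fc f q ^ 2 ≠ 0 → |gaussCurv f ν q| ≤ C) ↔
      (∀ᶠ u in nhds (0 : ℝ),
        ⟪pu (pu f) (u, 0), ν (u, 0)⟫ *
          det3 (pu f (u, 0)) (pv (pv f) (u, 0)) (pv (pv (pv f)) (u, 0)) = 0) := by
  have hD := contDiff_firstFormDet hf
  have hP := contDiff_secondFormDet hf hν
  have hperp : ∀ q, ⟪ν q, pv f q⟫ = 0 := fun q => (hfrontal q).2.2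
  have hD0 : ∀ᶠ u in nhds (0 : ℝ), firstFormDet f (u, 0) = 0 ∧ pv (firstFormDet f) (u, 0) = 0 := by
    filter_upwards [hadapted] with u hu
    exact ⟨firstFormDet_eq_zero hu.1, pv_firstFormDet_eq_zero hf hu.1⟩
  have hDlow : ∀ᶠ q in nhds ((0, 0) : ℝ × ℝ), 1 / 2 * q.2 ^ 2 ≤ firstFormDet f q := by
    obtain ⟨h0, h1, h2, h3, -⟩ := hadapted.self_of_nhds
    refine eventually_mul_sq_le hD hD0 ?_
    rw [pv_pv_firstFormDet hf h0 h1 h2 h3]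
    norm_num
  have hP0 : ∀ᶠ u in nhds (0 : ℝ), secondFormDet f ν (u, 0) = 0 ∧
      2 * pv (secondFormDet f ν) (u, 0) = ⟪pu (pu f) (u, 0), ν (u, 0)⟫ *
          det3 (pu f (u, 0)) (pv (pv f) (u, 0)) (pv (pv (pv f)) (u, 0)) := by
    filter_upwards [hadapted, hadapted.eventually_nhds] with u hu hu'
    have huv : pv (pu f) (u, 0) = 0 := by
      rw [pv_pu_comm hf]
      refine (hasDerivAt_pu hf.pv u 0).unique
        ((hasDerivAt_const u (0 : E3)).congr_of_eventuallyEq ?_)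
      filter_upwards [hu'] with t ht using ht.1
    have hM : Mc f ν (u, 0) = 0 := by simp [Mc, huv]
    have hN : Nc f ν (u, 0) = 0 := by rw [Nc_eq hf hν hperp]; simp [hu.1]
    refine ⟨by simp [secondFormDet, hM, hN], ?_⟩
    have hPv : pv (secondFormDet f ν) (u, 0) = _ :=
      pv_mul_sub_sq (contDiff_Lc hf hν) (contDiff_Nc hf hν) (contDiff_Mc hf hν) (u, 0)
    rw [hPv, hM, hN, ← inner_cross3, ← hu.2.2.2.2, ← two_mul_pv_Nc hf hν hperp hu.1, Lc]
    ring
  constructor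
  · rintro ⟨W, C, hW, h0W, hK⟩
    have hbound : ∀ᶠ q in nhds ((0, 0) : ℝ × ℝ), q.2 ≠ 0 →
        |secondFormDet f ν q| ≤ C * |firstFormDet f q| := by
      filter_upwards [hreg, hW.mem_nhds h0W] with q hq hqW hv
      have h := hK q hqW (hq hv)
      rw [gaussCurv, abs_div, div_le_iff₀ (abs_pos.2 (hq hv))] at h
      exact h
    have hbound' : ∀ᶠ u in nhds (0 : ℝ), ∀ᶠ v in nhds (0 : ℝ), v ≠ 0 →
        |secondFormDet f ν (u, v)| ≤ C * |firstFormDet f (u, v)| := by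
      rw [nhds_prod_eq] at hbound
      exact hbound.curry.mono fun u hu => hu
    filter_upwards [hbound', hD0, hP0] with u hu hDu hPu
    rw [← hPu.2, pv_eq_zero_of_abs_le hP hD hPu.1 hDu.1 hDu.2 hu, mul_zero]
  · intro hκ
    have hP1 : ∀ᶠ u in nhds (0 : ℝ),
        secondFormDet f ν (u, 0) = 0 ∧ pv (secondFormDet f ν) (u, 0) = 0 := by
      filter_upwards [hκ, hP0] with u hu hPu
      exact ⟨hPu.1, by linarith [hPu.2]⟩
    obtain ⟨C, hC, hPle⟩ := exists_eventually_abs_le_mul_sq hP hP1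
    obtain ⟨W, hWsub, hW, h0W⟩ := eventually_nhds_iff.1 (hDlow.and hPle)
    refine ⟨W, 2 * C, hW, h0W, fun q hq hne => ?_⟩
    obtain ⟨h1, h2⟩ := hWsub q hq
    rw [gaussCurv, abs_div, div_le_iff₀ (abs_pos.2 hne)]
    calc |secondFormDet f ν q| ≤ C * q.2 ^ 2 := h2
      _ = 2 * C * (1 / 2 * q.2 ^ 2) := by ring
      _ ≤ 2 * C * |firstFormDet f q| := by
        gcongr
        exact h1.trans (le_abs_self _)
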